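/- The field L = ℚ(√3, √13, √(4+√13)) is a Galois extension of ℚ of degree 8 with Galois group isomorphic to the dihedral group D₈ of order 8, and L/ℚ is unramified outside {2, 3, 13}. -/

import Mathlib

set_option synthInstance.maxHeartbeats 1000000
set_option maxHeartbeats 1000000

/-- The field `L = ℚ(√3, √13, √(4+√13))`, realized inside `ℝ`. -/
noncomputable def L18 : IntermediateField ℚ ℝ :=
  IntermediateField.adjoin ℚ
    ({Real.sqrt 3, Real.sqrt 13, Real.sqrt (4 + Real.sqrt 13)} : Set ℝ)

open IntermediateField Polynomial NumberField

section QuadraticStep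

variable {k K : Type*} [Field k] [Field K] [Algebra k K]

lemma exists_eq_add_mul_of_mem_adjoin_sqrt {F : IntermediateField k K} {x : K}
    (hx : x ^ 2 ∈ F) (hxF : x ∉ F) {y : K} (hy : y ∈ adjoin F {x}) :
    ∃ a ∈ F, ∃ b ∈ F, y = a + b * x := by
  induction hy using adjoin_induction with
  | mem z hz => exact ⟨0, zero_mem F, 1, one_mem F, by rw [Set.mem_singleton_iff.1 hz]; ring⟩
  | algebraMap z => exact ⟨z, z.2, 0, zero_mem F, by simp⟩
  | add z w _ _ hz hw =>
    obtain ⟨a, ha, b, hb, rfl⟩ := hz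
    obtain ⟨c, hc, d, hd, rfl⟩ := hw
    exact ⟨a + c, add_mem ha hc, b + d, add_mem hb hd, by ring⟩
  | mul z w _ _ hz hw =>
    obtain ⟨a, ha, b, hb, rfl⟩ := hz
    obtain ⟨c, hc, d, hd, rfl⟩ := hw
    exact ⟨a * c + b * d * x ^ 2, add_mem (mul_mem ha hc) (mul_mem (mul_mem hb hd) hx),
      a * d + b * c, add_mem (mul_mem ha hd) (mul_mem hb hc), by ring⟩
  | inv z _ hz =>
    obtain ⟨a, ha, b, hb, rfl⟩ := hz
    have hN : a ^ 2 - b ^ 2 * x ^ 2 ∈ F := sub_mem (pow_mem ha 2) (mul_mem (pow_mem hb 2) hx)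
    by_cases h0 : a + b * x = 0
    · exact ⟨0, zero_mem F, 0, zero_mem F, by simp [h0]⟩
    have h1 : a - b * x ≠ 0 := by
      intro h1
      by_cases hb0 : b = 0
      · subst hb0
        simp_all
      · apply hxF
        have : x = a / b := by
          field_simp
          linear_combination -h1
        rw [this]
        exact div_mem ha hb
    have hne : a ^ 2 - b ^ 2 * x ^ 2 ≠ 0 := by
      rw [show a ^ 2 - b ^ 2 * x ^ 2 = (a + b * x) * (a - b * x) by ring]
      exact mul_ne_zero h0 h1
    refine ⟨a / (a ^ 2 - b ^ 2 * x ^ 2), div_mem ha hN,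
      -b / (a ^ 2 - b ^ 2 * x ^ 2), div_mem (neg_mem hb) hN, ?_⟩
    field_simp
    ring

lemma finrank_adjoin_sqrt {F : IntermediateField k K} {x : K}
    (hx : x ^ 2 ∈ F) (hxF : x ∉ F) : Module.finrank F (adjoin F {x}) = 2 := by
  have hroot : aeval x (X ^ 2 - C (⟨x ^ 2, hx⟩ : F)) = 0 := by simp
  have hmonic : (X ^ 2 - C (⟨x ^ 2, hx⟩ : F)).Monic := monic_X_pow_sub_C _ two_ne_zero
  have hint : IsIntegral F x := ⟨_, hmonic, hroot⟩
  rw [adjoin.finrank hint]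
  apply le_antisymm
  · have h := natDegree_le_natDegree (minpoly.min F x hmonic hroot)
    rwa [natDegree_X_pow_sub_C] at h
  · rw [minpoly.two_le_natDegree_iff hint]
    rintro ⟨y, rfl⟩
    exact hxF y.2

end QuadraticStep

section Degree

lemma irrational_sqrt_three : Irrational (√3 : ℝ) := by
  simpa using Nat.prime_three.irrational_sqrt

lemma irrational_sqrt_thirteen : Irrational (√13 : ℝ) := by
  simpa using (show Nat.Prime 13 by norm_num).irrational_sqrt

lemma sq_ne_three (q : ℚ) : (q : ℝ) ^ 2 ≠ 3 := by
  intro h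
  apply irrational_sqrt_three
  refine ⟨|q|, ?_⟩
  rw [← h, Real.sqrt_sq_eq_abs]
  simp

lemma sq_ne_thirty_nine (q : ℚ) : (q : ℝ) ^ 2 ≠ 39 := by
  intro h
  have h' : q * q = 39 := by
    have : q ^ 2 = 39 := by exact_mod_cast h
    linarith
  have : IsSquare (39 : ℚ) := ⟨q, h'.symm⟩
  have h39 : ¬ IsSquare (39 : ℕ) := by
    rintro ⟨r, hr⟩
    have : r ≤ 6 := by nlinarith
    interval_cases r <;> omega
  exact h39 (by exact_mod_cast Rat.isSquare_natCast_iff.1 (by exact_mod_cast this))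

lemma add_mul_sqrt_thirteen_inj {a b c d : ℚ} (h : (a + b * √13 : ℝ) = c + d * √13) :
    a = c ∧ b = d := by
  by_cases hbd : b = d
  · subst hbd
    exact ⟨by exact_mod_cast add_right_cancel h, rfl⟩
  · exfalso
    apply irrational_sqrt_thirteen
    have hne : (b - d : ℝ) ≠ 0 := by
      rw [sub_ne_zero]
      exact_mod_cast hbd
    refine ⟨(c - a) / (b - d), ?_⟩
    push_cast
    field_simp
    linear_combination -h

/-- The subfield `ℚ(√13)` of `ℝ`. -/
noncomputable def sqrtThirteenField : IntermediateField ℚ ℝ :=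
  (adjoin (⊥ : IntermediateField ℚ ℝ) {√13}).restrictScalars ℚ

/-- The subfield `ℚ(√13, √3)` of `ℝ`. -/
noncomputable def sqrtThirteenThreeField : IntermediateField ℚ ℝ :=
  (adjoin sqrtThirteenField {√3}).restrictScalars ℚ

lemma sqrt_thirteen_notMem_bot : (√13 : ℝ) ∉ (⊥ : IntermediateField ℚ ℝ) := by
  rw [mem_bot]
  exact irrational_sqrt_thirteen

lemma sqrt_thirteen_sq : (√13 : ℝ) ^ 2 = 13 := Real.sq_sqrt (by norm_num)

lemma sqrt_three_sq : (√3 : ℝ) ^ 2 = 3 := Real.sq_sqrt (by norm_num)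

lemma sqrt_four_add_sq : √(4 + √13) ^ 2 = 4 + √13 := Real.sq_sqrt (by positivity)

lemma sqrt_thirteen_sq_mem (F : IntermediateField ℚ ℝ) : (√13 : ℝ) ^ 2 ∈ F := by
  rw [sqrt_thirteen_sq]
  exact ofNat_mem F 13

lemma sqrt_three_sq_mem (F : IntermediateField ℚ ℝ) : (√3 : ℝ) ^ 2 ∈ F := by
  rw [sqrt_three_sq]
  exact ofNat_mem F 3

lemma exists_rat_of_mem_sqrtThirteenField {y : ℝ} (hy : y ∈ sqrtThirteenField) :
    ∃ a b : ℚ, y = a + b * √13 := by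
  obtain ⟨a, ha, b, hb, rfl⟩ := exists_eq_add_mul_of_mem_adjoin_sqrt
    (sqrt_thirteen_sq_mem _) sqrt_thirteen_notMem_bot hy
  obtain ⟨a, rfl⟩ := mem_bot.1 ha
  obtain ⟨b, rfl⟩ := mem_bot.1 hb
  exact ⟨a, b, rfl⟩

lemma sqrt_thirteen_mem : (√13 : ℝ) ∈ sqrtThirteenField :=
  mem_adjoin_simple_self (⊥ : IntermediateField ℚ ℝ) (√13 : ℝ)

lemma sqrt_three_notMem : (√3 : ℝ) ∉ sqrtThirteenField := by
  intro h
  obtain ⟨a, b, hab⟩ := exists_rat_of_mem_sqrtThirteenField h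
  have h2 : ((a ^ 2 + 13 * b ^ 2 : ℚ) + (2 * a * b : ℚ) * √13 : ℝ) = (3 : ℚ) + (0 : ℚ) * √13 := by
    have := sqrt_three_sq
    rw [hab] at this
    push_cast
    linear_combination this - (b : ℝ) ^ 2 * sqrt_thirteen_sq
  obtain ⟨h3, h4⟩ := add_mul_sqrt_thirteen_inj h2
  have h5 : a = 0 ∨ b = 0 := by simpa using h4
  rcases h5 with rfl | rfl
  · apply sq_ne_thirty_nine (13 * b)
    exact_mod_cast (by linear_combination 13 * h3 : (13 * b) ^ 2 = 39)
  · apply sq_ne_three a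
    exact_mod_cast (by linear_combination h3 : a ^ 2 = 3)

lemma sq_ne_four_add_sqrt_thirteen {u : ℝ} (hu : u ∈ sqrtThirteenField) : u ^ 2 ≠ 4 + √13 := by
  intro h
  obtain ⟨a, b, rfl⟩ := exists_rat_of_mem_sqrtThirteenField hu
  have h2 : ((a ^ 2 + 13 * b ^ 2 : ℚ) + (2 * a * b : ℚ) * √13 : ℝ) = (4 : ℚ) + (1 : ℚ) * √13 := by
    push_cast
    linear_combination h - (b : ℝ) ^ 2 * sqrt_thirteen_sq
  obtain ⟨h3, h4⟩ := add_mul_sqrt_thirteen_inj h2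
  apply sq_ne_three (a ^ 2 - 13 * b ^ 2)
  exact_mod_cast (by
    linear_combination (a ^ 2 + 13 * b ^ 2 + 4) * h3 - 13 * (2 * a * b + 1) * h4 :
      (a ^ 2 - 13 * b ^ 2) ^ 2 = 3)

lemma three_mul_sq_ne_four_add_sqrt_thirteen {u : ℝ} (hu : u ∈ sqrtThirteenField) :
    3 * u ^ 2 ≠ 4 + √13 := by
  intro h
  obtain ⟨a, b, rfl⟩ := exists_rat_of_mem_sqrtThirteenField hu
  have h2 : ((3 * (a ^ 2 + 13 * b ^ 2) : ℚ) + (6 * a * b : ℚ) * √13 : ℝ) =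
      (4 : ℚ) + (1 : ℚ) * √13 := by
    push_cast
    linear_combination h - 3 * (b : ℝ) ^ 2 * sqrt_thirteen_sq
  obtain ⟨h3, h4⟩ := add_mul_sqrt_thirteen_inj h2
  apply sq_ne_three (3 * (a ^ 2 - 13 * b ^ 2))
  exact_mod_cast (by
    linear_combination (3 * (a ^ 2 + 13 * b ^ 2) + 4) * h3 - 13 * (6 * a * b + 1) * h4 :
      (3 * (a ^ 2 - 13 * b ^ 2)) ^ 2 = 3)

lemma sqrtThirteenField_le : sqrtThirteenField ≤ sqrtThirteenThreeField :=
  fun y hy => (adjoin sqrtThirteenField {√3}).algebraMap_mem ⟨y, hy⟩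

lemma sqrt_four_add_sq_mem : √(4 + √13) ^ 2 ∈ sqrtThirteenThreeField := by
  rw [sqrt_four_add_sq]
  exact add_mem (ofNat_mem _ 4) (sqrtThirteenField_le sqrt_thirteen_mem)

lemma sqrt_four_add_notMem : √(4 + √13) ∉ sqrtThirteenThreeField := by
  intro h
  obtain ⟨u, hu, v, hv, huv⟩ := exists_eq_add_mul_of_mem_adjoin_sqrt
    (sqrt_three_sq_mem _) sqrt_three_notMem h
  have h2 : u ^ 2 + 3 * v ^ 2 + 2 * u * v * √3 = 4 + √13 := by
    rw [← sqrt_four_add_sq, huv]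
    linear_combination -v ^ 2 * sqrt_three_sq
  by_cases h0 : u * v = 0
  · rcases mul_eq_zero.1 h0 with rfl | rfl
    · exact three_mul_sq_ne_four_add_sqrt_thirteen hv (by linear_combination h2)
    · exact sq_ne_four_add_sqrt_thirteen hu (by linear_combination h2)
  · apply sqrt_three_notMem
    have : √3 = (4 + √13 - u ^ 2 - 3 * v ^ 2) / (2 * (u * v)) := by
      rw [eq_div_iff (mul_ne_zero two_ne_zero h0)]
      linear_combination h2
    rw [this]
    exact div_mem (sub_mem (sub_mem (add_mem (ofNat_mem _ 4) sqrt_thirteen_mem) (pow_mem hu 2))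
      (mul_mem (ofNat_mem _ 3) (pow_mem hv 2))) (mul_mem (ofNat_mem _ 2) (mul_mem hu hv))

lemma L18_eq : L18 = (adjoin sqrtThirteenThreeField {√(4 + √13)}).restrictScalars ℚ := by
  apply le_antisymm
  · rw [L18, adjoin_le_iff]
    rintro y (rfl | rfl | rfl)
    · exact (adjoin sqrtThirteenThreeField {√(4 + √13)}).algebraMap_mem
        ⟨√3, mem_adjoin_simple_self sqrtThirteenField (√3 : ℝ)⟩
    · exact (adjoin sqrtThirteenThreeField {√(4 + √13)}).algebraMap_mem
        ⟨√13, sqrtThirteenField_le sqrt_thirteen_mem⟩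
    · exact mem_adjoin_simple_self sqrtThirteenThreeField √(4 + √13)
  · intro y hy
    obtain ⟨a, ha, b, hb, rfl⟩ := exists_eq_add_mul_of_mem_adjoin_sqrt
      sqrt_four_add_sq_mem sqrt_four_add_notMem hy
    have h3 : √3 ∈ L18 := subset_adjoin _ _ (by simp)
    have h13 : √13 ∈ L18 := subset_adjoin _ _ (by simp)
    have h4 : √(4 + √13) ∈ L18 := subset_adjoin _ _ (by simp)
    have key1 : ∀ z ∈ sqrtThirteenField, z ∈ L18 := by
      intro z hz
      obtain ⟨p, q, rfl⟩ := exists_rat_of_mem_sqrtThirteenField hz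
      exact add_mem (SubfieldClass.ratCast_mem L18 p) (mul_mem (SubfieldClass.ratCast_mem L18 q) h13)
    have key2 : ∀ z ∈ sqrtThirteenThreeField, z ∈ L18 := by
      intro z hz
      obtain ⟨u, hu, v, hv, rfl⟩ := exists_eq_add_mul_of_mem_adjoin_sqrt
        (sqrt_three_sq_mem _) sqrt_three_notMem hz
      exact add_mem (key1 u hu) (mul_mem (key1 v hv) h3)
    exact add_mem (key2 a ha) (mul_mem (key2 b hb) h4)

lemma finrank_L18 : Module.finrank ℚ L18 = 8 := by
  have h1 := finrank_adjoin_sqrt (sqrt_thirteen_sq_mem _) sqrt_thirteen_notMem_bot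
  have h2 := finrank_adjoin_sqrt (sqrt_three_sq_mem _) sqrt_three_notMem
  have h3 := finrank_adjoin_sqrt sqrt_four_add_sq_mem sqrt_four_add_notMem
  have t1 := Module.finrank_mul_finrank ℚ (⊥ : IntermediateField ℚ ℝ)
    (adjoin (⊥ : IntermediateField ℚ ℝ) {(√13 : ℝ)})
  have t2 := Module.finrank_mul_finrank ℚ sqrtThirteenField (adjoin sqrtThirteenField {(√3 : ℝ)})
  have t3 := Module.finrank_mul_finrank ℚ sqrtThirteenThreeField
    (adjoin sqrtThirteenThreeField {√(4 + √13)})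
  rw [IntermediateField.finrank_bot, h1] at t1
  have e1 : Module.finrank ℚ sqrtThirteenField = 2 := t1.symm
  rw [e1, h2] at t2
  have e2 : Module.finrank ℚ sqrtThirteenThreeField = 4 := t2.symm
  rw [e2, h3] at t3
  rw [L18_eq]
  exact t3.symm

end Degree

section DihedralGalois

variable {K : Type*} [Field K] {a b : K}

/-- The eight pairs `(±a, ±b)`, `(±b, ±a)`. -/
def signedPair {K : Type*} [Field K] (a b : K) : Bool × Bool × Bool → K × K
  | (false, s, t) => (if s then -a else a, if t then -b else b)
  | (true, s, t) => (if s then -b else b, if t then -a else a)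

lemma map_eq_or_of_sq {F : Type*} [Field F] [Algebra F K] (hsum : a ^ 2 + b ^ 2 = 8)
    (hprod : a ^ 2 * b ^ 2 = 3) (σ : Gal(K/F)) :
    (σ a = a ∨ σ a = -a) ∧ (σ b = b ∨ σ b = -b) ∨
      (σ a = b ∨ σ a = -b) ∧ (σ b = a ∨ σ b = -a) := by
  have h1 : σ a ^ 2 + σ b ^ 2 = 8 := by
    simpa [map_ofNat] using congrArg σ hsum
  have h2 : σ a ^ 2 * σ b ^ 2 = 3 := by
    simpa [map_ofNat] using congrArg σ hprod
  have h3 : (σ a ^ 2 - a ^ 2) * (σ a ^ 2 - b ^ 2) = 0 := by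
    linear_combination (σ a ^ 2) * h1 - h2 - (σ a ^ 2) * hsum + hprod
  rcases mul_eq_zero.1 h3 with h | h
  · left
    exact ⟨sq_eq_sq_iff_eq_or_eq_neg.1 (by linear_combination h),
      sq_eq_sq_iff_eq_or_eq_neg.1 (by linear_combination h1 - hsum - h)⟩
  · right
    exact ⟨sq_eq_sq_iff_eq_or_eq_neg.1 (by linear_combination h),
      sq_eq_sq_iff_eq_or_eq_neg.1 (by linear_combination h1 - hsum - h)⟩

variable {F : Type*} [Field F] [Algebra F K]

lemma algEquiv_eq_of_adjoin_eq_top (htop : adjoin F {a, b} = ⊤) {σ τ : Gal(K/F)}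
    (ha : σ a = τ a) (hb : σ b = τ b) : σ = τ := by
  have h : (σ : K →ₐ[F] K) = τ := by
    have hle : adjoin F {a, b} ≤
        (AlgHom.equalizer (σ : K →ₐ[F] K) (τ : K →ₐ[F] K)).toIntermediateField
          (fun x hx => by
            have : σ x = τ x := hx
            change σ x⁻¹ = τ x⁻¹
            rw [map_inv₀, map_inv₀, this]) := by
      rw [adjoin_le_iff]
      rintro y (rfl | rfl)
      · exact ha
      · exact hb
    ext y
    exact hle (htop ▸ mem_top : y ∈ adjoin F {a, b})
  ext y
  exact DFunLike.congr_fun h y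

lemma exists_algEquiv_of_card_eq_eight (hsum : a ^ 2 + b ^ 2 = 8) (hprod : a ^ 2 * b ^ 2 = 3)
    (htop : adjoin F {a, b} = ⊤) (hcard : Nat.card Gal(K/F) = 8) (i : Bool × Bool × Bool) :
    ∃ σ : Gal(K/F), (σ a, σ b) = signedPair a b i := by
  classical
  have : Finite Gal(K/F) := Nat.finite_of_card_ne_zero (by omega)
  have := Fintype.ofFinite Gal(K/F)
  let f : Gal(K/F) → K × K := fun σ => (σ a, σ b)
  have hf : Function.Injective f := fun σ τ h =>
    algEquiv_eq_of_adjoin_eq_top htop (congrArg Prod.fst h) (congrArg Prod.snd h)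
  have hsub : Finset.univ.image f ⊆ Finset.univ.image (signedPair a b) := by
    intro z hz
    obtain ⟨σ, -, rfl⟩ := Finset.mem_image.1 hz
    rw [Finset.mem_image]
    rcases map_eq_or_of_sq hsum hprod σ with ⟨h1, h2⟩ | ⟨h1, h2⟩
    · rcases h1 with h1 | h1 <;> rcases h2 with h2 | h2
      · exact ⟨(false, false, false), Finset.mem_univ _, by simp [f, signedPair, h1, h2]⟩
      · exact ⟨(false, false, true), Finset.mem_univ _, by simp [f, signedPair, h1, h2]⟩
      · exact ⟨(false, true, false), Finset.mem_univ _, by simp [f, signedPair, h1, h2]⟩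
      · exact ⟨(false, true, true), Finset.mem_univ _, by simp [f, signedPair, h1, h2]⟩
    · rcases h1 with h1 | h1 <;> rcases h2 with h2 | h2
      · exact ⟨(true, false, false), Finset.mem_univ _, by simp [f, signedPair, h1, h2]⟩
      · exact ⟨(true, false, true), Finset.mem_univ _, by simp [f, signedPair, h1, h2]⟩
      · exact ⟨(true, true, false), Finset.mem_univ _, by simp [f, signedPair, h1, h2]⟩
      · exact ⟨(true, true, true), Finset.mem_univ _, by simp [f, signedPair, h1, h2]⟩
  have heq : Finset.univ.image f = Finset.univ.image (signedPair a b) := by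
    apply Finset.eq_of_subset_of_card_le hsub
    rw [Finset.card_image_of_injective _ hf, Finset.card_univ, ← Nat.card_eq_fintype_card, hcard]
    exact Finset.card_image_le.trans (by simp)
  have hi : signedPair a b i ∈ Finset.univ.image f := by
    rw [heq]
    exact Finset.mem_image_of_mem _ (Finset.mem_univ _)
  obtain ⟨σ, -, h⟩ := Finset.mem_image.1 hi
  exact ⟨σ, h⟩

/-- The homomorphism from a dihedral group given by a rotation and a reflection. -/
def dihedralLift {G : Type*} [Group G] {n : ℕ} [NeZero n] (ρ s : G) (hρ : ρ ^ n = 1)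
    (hs : s * s = 1) (hconj : ρ * s * ρ = s) : DihedralGroup n →* G :=
  MonoidHom.mk'
    (fun
      | .r i => ρ ^ i.val
      | .sr i => s * ρ ^ i.val)
    (by
      have hadd : ∀ i j : ZMod n, ρ ^ (i + j).val = ρ ^ i.val * ρ ^ j.val := by
        intro i j
        rw [ZMod.val_add, ← pow_add, ← pow_eq_pow_mod _ hρ]
      have hcomm : ∀ m : ℕ, ρ ^ m * s * ρ ^ m = s := by
        intro m
        induction m with
        | zero => simp
        | succ m ih =>
          calc ρ ^ (m + 1) * s * ρ ^ (m + 1) = ρ ^ m * (ρ * s * ρ) * ρ ^ m := by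
                nth_rewrite 1 [pow_succ]
                rw [pow_succ']
                simp only [mul_assoc]
            _ = s := by rw [hconj, ih]
      have hsub : ∀ i j : ZMod n, ρ ^ i.val * s * ρ ^ j.val = s * ρ ^ (j - i).val := by
        intro i j
        have h := hadd i (j - i)
        rw [add_sub_cancel] at h
        rw [h, ← mul_assoc, hcomm]
      rintro (i | i) (j | j)
      · simp only [DihedralGroup.r_mul_r]
        exact hadd i j
      · simp only [DihedralGroup.r_mul_sr]
        rw [← hsub, mul_assoc]
      · simp only [DihedralGroup.sr_mul_r]
        rw [hadd, mul_assoc]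
      · simp only [DihedralGroup.sr_mul_sr]
        rw [mul_assoc s, ← mul_assoc (ρ ^ i.val), hsub, ← mul_assoc, hs, one_mul])

lemma nonempty_mulEquiv_dihedralGroup [CharZero K] (hsum : a ^ 2 + b ^ 2 = 8) (hprod : a ^ 2 * b ^ 2 = 3)
    (htop : adjoin F {a, b} = ⊤) (hcard : Nat.card Gal(K/F) = 8) :
    Nonempty (Gal(K/F) ≃* DihedralGroup 4) := by
  obtain ⟨ρ, hρ⟩ := exists_algEquiv_of_card_eq_eight hsum hprod htop hcard (true, false, true)
  obtain ⟨s, hs⟩ := exists_algEquiv_of_card_eq_eight hsum hprod htop hcard (true, false, false)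
  simp only [signedPair, Prod.mk.injEq, if_true, Bool.false_eq_true, if_false] at hρ hs
  obtain ⟨hρa, hρb⟩ := hρ
  obtain ⟨hsa, hsb⟩ := hs
  have ha0 : a ≠ 0 := by
    rintro rfl
    norm_num at hprod
  have hb0 : b ≠ 0 := by
    rintro rfl
    norm_num at hprod
  have hsq : a ^ 2 ≠ b ^ 2 := by
    intro h
    rw [← h] at hsum hprod
    have h4 : a ^ 2 = 4 := by linear_combination hsum / 2
    rw [h4] at hprod
    norm_num at hprod
  have hab : b ≠ a := fun h => hsq (by rw [h])
  have hab' : -b ≠ a := fun h => hsq (by rw [← h]; ring)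
  have hna : -a ≠ a := fun h => ha0 (self_eq_neg.1 h.symm)
  have hnb : -b ≠ b := fun h => hb0 (self_eq_neg.1 h.symm)
  have hρ4 : ρ ^ 4 = 1 := algEquiv_eq_of_adjoin_eq_top htop
    (by simp [pow_succ, hρa, hρb]) (by simp [pow_succ, hρa, hρb])
  have hs2 : s * s = 1 := algEquiv_eq_of_adjoin_eq_top htop
    (by simp [hsa, hsb]) (by simp [hsa, hsb])
  have hconj : ρ * s * ρ = s := algEquiv_eq_of_adjoin_eq_top htop
    (by simp [hsa, hsb, hρa]) (by simp [hsa, hsb, hρb])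
  let φ : DihedralGroup 4 →* Gal(K/F) := dihedralLift ρ s hρ4 hs2 hconj
  have hφr : ∀ i : ZMod 4, φ (.r i) = ρ ^ i.val := fun _ => rfl
  have hφsr : ∀ i : ZMod 4, φ (.sr i) = s * ρ ^ i.val := fun _ => rfl
  have hinj : Function.Injective φ := by
    rw [injective_iff_map_eq_one]
    rintro (i | i) h
    · rw [hφr] at h
      have h1 := DFunLike.congr_fun h a
      fin_cases i
      · rfl
      all_goals
        exfalso
        simp [ZMod.val, pow_succ, hρa, hρb] at h1
        first | exact hab h1 | exact hna h1 | exact hab' h1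
    · rw [hφsr] at h
      have h1 := DFunLike.congr_fun h a
      have h2 := DFunLike.congr_fun h b
      exfalso
      fin_cases i <;> simp [ZMod.val, pow_succ, hρa, hρb, hsa, hsb] at h1 h2 <;>
        first | exact hab h1 | exact hna h1 | exact hab' h1 | exact hnb h2
  have : Finite Gal(K/F) := Nat.finite_of_card_ne_zero (by omega)
  have hbij : Function.Bijective φ := (Nat.bijective_iff_injective_and_card φ).2
    ⟨hinj, by rw [hcard, DihedralGroup.nat_card]⟩
  exact ⟨(MulEquiv.ofBijective φ hbij).symm⟩

end DihedralGalois

section Ramification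

/-- A prime whose square divides a rational prime in a Galois number field has a nontrivial
inertia group. -/
lemma exists_ne_one_forall_smul_sub_mem {K : Type*} [Field K] [NumberField K] [IsGalois ℚ K]
    {p : ℕ} (hp : p.Prime) {P : Ideal (𝓞 K)} (hP : P.IsPrime)
    (hdvd : P ^ 2 ∣ Ideal.span {(p : 𝓞 K)}) :
    ∃ σ : Gal(K/ℚ), σ ≠ 1 ∧ ∀ x : 𝓞 K, σ • x - x ∈ P := by
  by_contra! hcon
  have hp0 : Ideal.span {(p : ℤ)} ≠ ⊥ := by simpa using hp.ne_zero
  have hpmax : (Ideal.span {(p : ℤ)}).IsMaximal :=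
    PrincipalIdealRing.isMaximal_of_irreducible (Nat.prime_iff_prime_int.1 hp).irreducible
  have hmap : (Ideal.span {(p : ℤ)}).map (algebraMap ℤ (𝓞 K)) = Ideal.span {(p : 𝓞 K)} := by
    rw [Ideal.map_span, Set.image_singleton]
    simp
  have hle : (Ideal.span {(p : ℤ)}).map (algebraMap ℤ (𝓞 K)) ≤ P ^ 2 := by
    rw [hmap]
    exact Ideal.dvd_iff_le.1 hdvd
  have hle1 : (Ideal.span {(p : ℤ)}).map (algebraMap ℤ (𝓞 K)) ≤ P :=
    hle.trans (Ideal.pow_le_self two_ne_zero)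
  have hover : P.LiesOver (Ideal.span {(p : ℤ)}) :=
    ⟨hpmax.eq_of_le (Ideal.IsPrime.ne_top inferInstance) (Ideal.map_le_iff_le_comap.1 hle1)⟩
  have hcard : Nat.card (P.inertia Gal(K/ℚ)) = 1 := by
    rw [Nat.card_eq_one_iff_unique]
    refine ⟨⟨fun σ τ => ?_⟩, ⟨1⟩⟩
    have key : ∀ σ : P.inertia Gal(K/ℚ), (σ : Gal(K/ℚ)) = 1 := by
      intro σ
      by_contra h
      obtain ⟨x, hx⟩ := hcon σ h
      exact hx (σ.2 x)
    exact Subtype.ext ((key σ).trans (key τ).symm)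
  rw [Ideal.card_inertia_eq_ramificationIdxIn (Ideal.span {(p : ℤ)}) P,
    Ideal.ramificationIdxIn_eq_ramificationIdx (Ideal.span {(p : ℤ)}) P Gal(K/ℚ),
    ← Ideal.ramificationIdx'_eq_ramificationIdx (Ideal.span {(p : ℤ)}) P hp0] at hcard
  exact (Ideal.ramificationIdx'_ne_one_iff hle1).2 hle hcard

lemma not_sq_dvd_span_of_sq_add_sq_eq_eight {K : Type*} [Field K] [NumberField K] [IsGalois ℚ K]
    {a b : K} (hsum : a ^ 2 + b ^ 2 = 8) (hprod : a ^ 2 * b ^ 2 = 3)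
    (htop : adjoin ℚ {a, b} = ⊤) {p : ℕ} (hp : p.Prime) (hcop : p.Coprime 156)
    {P : Ideal (𝓞 K)} (hP : P.IsPrime) : ¬ P ^ 2 ∣ Ideal.span {(p : 𝓞 K)} := by
  intro hdvd
  obtain ⟨σ, hσ, hin⟩ := exists_ne_one_forall_smul_sub_mem hp hP hdvd
  have hpP : (p : 𝓞 K) ∈ P := Ideal.pow_le_self two_ne_zero
    (Ideal.dvd_iff_le.1 hdvd (Ideal.mem_span_singleton_self _))
  have h156 : (156 : 𝓞 K) ∉ P := by
    intro h
    obtain ⟨u, v, huv⟩ := Nat.isCoprime_iff_coprime.2 hcop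
    apply hP.ne_top
    rw [Ideal.eq_top_iff_one]
    have h1 : (u : 𝓞 K) * (p : 𝓞 K) + v * 156 = 1 := by exact_mod_cast congrArg (Int.cast : ℤ → 𝓞 K) huv
    rw [← h1]
    exact add_mem (P.mul_mem_left _ hpP) (P.mul_mem_left _ h)
  have hinta : IsIntegral ℤ a := by
    refine ⟨X ^ 4 - 8 * X ^ 2 + 3, by monicity!, ?_⟩
    simp
    linear_combination (a ^ 2) * hsum - hprod
  have hintb : IsIntegral ℤ b := by
    refine ⟨X ^ 4 - 8 * X ^ 2 + 3, by monicity!, ?_⟩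
    simp
    linear_combination (b ^ 2) * hsum - hprod
  let A : 𝓞 K := ⟨a, hinta⟩
  let B : 𝓞 K := ⟨b, hintb⟩
  have hAB : A ^ 2 + B ^ 2 = 8 := Subtype.ext hsum
  have hAB' : A ^ 2 * B ^ 2 = 3 := Subtype.ext hprod
  have hA : ((σ • A : 𝓞 K) : K) = σ a := rfl
  have hB : ((σ • B : 𝓞 K) : K) = σ b := rfl
  have hinA := hin A
  have hinB := hin B
  have hdiff : A - B ∉ P ∧ A + B ∉ P := by
    have h : ((A - B) * (A + B)) ^ 2 = 52 := by
      linear_combination (A ^ 2 + B ^ 2 + 8) * hAB - 4 * hAB'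
    constructor <;> intro hm <;> apply h156
    · have : (156 : 𝓞 K) = 3 * (A - B) * (A + B) ^ 2 * (A - B) := by linear_combination -3 * h
      rw [this]
      exact P.mul_mem_left _ hm
    · have : (156 : 𝓞 K) = 3 * (A - B) ^ 2 * (A + B) * (A + B) := by linear_combination -3 * h
      rw [this]
      exact P.mul_mem_left _ hm
  have h2A : 2 * A ∉ P := by
    intro hm
    apply h156
    have : (156 : 𝓞 K) = 26 * A * B ^ 2 * (2 * A) := by linear_combination -52 * hAB'
    rw [this]
    exact P.mul_mem_left _ hm
  have h2B : 2 * B ∉ P := by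
    intro hm
    apply h156
    have : (156 : 𝓞 K) = 26 * B * A ^ 2 * (2 * B) := by linear_combination -52 * hAB'
    rw [this]
    exact P.mul_mem_left _ hm
  rcases map_eq_or_of_sq hsum hprod σ with ⟨h1, h2⟩ | ⟨h1, h2⟩
  · have ha : σ a = a := by
      refine h1.resolve_right fun h => h2A ?_
      have : σ • A = -A := RingOfIntegers.ext (hA.trans h)
      rw [this] at hinA
      rw [← neg_mem_iff]
      convert hinA using 1
      ring
    have hb : σ b = b := by
      refine h2.resolve_right fun h => h2B ?_
      have : σ • B = -B := RingOfIntegers.ext (hB.trans h)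
      rw [this] at hinB
      rw [← neg_mem_iff]
      convert hinB using 1
      ring
    exact hσ (algEquiv_eq_of_adjoin_eq_top htop ha hb)
  · rcases h1 with h | h
    · have : σ • A = B := RingOfIntegers.ext (hA.trans h)
      rw [this] at hinA
      exact hdiff.1 ((sub_mem_comm_iff).1 hinA)
    · have : σ • A = -B := RingOfIntegers.ext (hA.trans h)
      rw [this] at hinA
      apply hdiff.2
      rw [← neg_mem_iff]
      convert hinA using 1
      ring

end Ramification

section SplittingField

variable {F E : Type*} [Field F] [Field E] [Algebra F E] {a b : E}

lemma map_quartic_eq (hsum : a ^ 2 + b ^ 2 = 8) (hprod : a ^ 2 * b ^ 2 = 3) :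
    (X ^ 4 - 8 * X ^ 2 + 3 : F[X]).map (algebraMap F E) =
      (X - C a) * (X - C (-a)) * ((X - C b) * (X - C (-b))) := by
  have h1 : (C a ^ 2 + C b ^ 2 : E[X]) = 8 := by
    rw [← C_pow, ← C_pow, ← C_add, hsum]
    rfl
  have h2 : (C a ^ 2 * C b ^ 2 : E[X]) = 3 := by
    rw [← C_pow, ← C_pow, ← C_mul, hprod]
    rfl
  simp only [Polynomial.map_add, Polynomial.map_sub, Polynomial.map_mul, Polynomial.map_pow, map_X,
    Polynomial.map_ofNat, C_neg]
  linear_combination X ^ 2 * h1 - h2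

lemma isGalois_of_sq_add_sq_eq_eight [CharZero F] (hsum : a ^ 2 + b ^ 2 = 8)
    (hprod : a ^ 2 * b ^ 2 = 3) (htop : adjoin F {a, b} = ⊤) : IsGalois F E := by
  have hmap := map_quartic_eq (F := F) hsum hprod
  have : (X ^ 4 - 8 * X ^ 2 + 3 : F[X]).IsSplittingField F E := by
    rw [isSplittingField_iff_intermediateField]
    constructor
    · rw [hmap]
      exact ((Splits.X_sub_C _).mul (Splits.X_sub_C _)).mul
        ((Splits.X_sub_C _).mul (Splits.X_sub_C _))
    · rw [eq_top_iff, ← htop]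
      apply adjoin.mono
      have hne : (X ^ 4 - 8 * X ^ 2 + 3 : F[X]) ≠ 0 := by
        apply Monic.ne_zero
        monicity!
      rintro y (rfl | rfl) <;> rw [mem_rootSet_of_ne hne] <;>
        simp only [map_add, map_sub, map_mul, map_pow, aeval_X, map_ofNat]
      · linear_combination (y ^ 2) * hsum - hprod
      · linear_combination (y ^ 2) * hsum - hprod
  have := Normal.of_isSplittingField (F := F) (E := E) (X ^ 4 - 8 * X ^ 2 + 3 : F[X])
  exact ⟨⟩

end SplittingField

lemma adjoin_pair_eq_top {k K : Type*} [Field k] [Field K] [Algebra k K]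
    {F : IntermediateField k K} {a b : K} (ha : a ∈ F) (hb : b ∈ F) (hle : F ≤ adjoin k {a, b}) :
    adjoin k {(⟨a, ha⟩ : F), ⟨b, hb⟩} = ⊤ := by
  apply lift_injective F
  rw [lift_adjoin, lift_top, Set.image_pair]
  refine le_antisymm ?_ hle
  rw [adjoin_le_iff]
  rintro _ (rfl | rfl)
  · exact ha
  · exact hb

lemma exists_generators_L18 : ∃ a b : L18, a ^ 2 + b ^ 2 = 8 ∧ a ^ 2 * b ^ 2 = 3 ∧
    adjoin ℚ {a, b} = ⊤ := by
  have h3 : √3 ∈ L18 := subset_adjoin _ _ (by simp)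
  have h13 : √13 ∈ L18 := subset_adjoin _ _ (by simp)
  have h4 : √(4 + √13) ∈ L18 := subset_adjoin _ _ (by simp)
  have hpos : 0 < √(4 + √13) := Real.sqrt_pos.2 (by positivity)
  have ha := sqrt_four_add_sq
  set α := √(4 + √13) with hα
  have hβ : (√3 / α) ^ 2 = 4 - √13 := by
    rw [div_pow, ha, sqrt_three_sq, div_eq_iff (by positivity)]
    linear_combination sqrt_thirteen_sq
  refine ⟨⟨α, h4⟩, ⟨√3 / α, div_mem h3 h4⟩, ?_, ?_, ?_⟩
  · apply Subtype.ext
    change α ^ 2 + (√3 / α) ^ 2 = 8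
    rw [ha, hβ]
    ring
  · apply Subtype.ext
    change α ^ 2 * (√3 / α) ^ 2 = 3
    rw [ha, hβ]
    linear_combination -sqrt_thirteen_sq
  · apply adjoin_pair_eq_top h4 (div_mem h3 h4)
    have m1 : α ∈ adjoin ℚ {α, √3 / α} := subset_adjoin _ _ (by simp)
    have m2 : √3 / α ∈ adjoin ℚ {α, √3 / α} := subset_adjoin _ _ (by simp)
    conv_lhs => rw [L18]
    rw [adjoin_le_iff]
    rintro y (rfl | rfl | rfl)
    · have := mul_mem m1 m2
      rwa [mul_div_cancel₀ _ hpos.ne'] at this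
    · have := sub_mem (pow_mem m1 2) (ofNat_mem _ 4)
      rwa [ha, add_sub_cancel_left] at this
    · exact m1

/-- `L = ℚ(√3, √13, √(4+√13))` is a Galois extension of `ℚ` of degree 8 with Galois group
isomorphic to the dihedral group of order 8, and `L/ℚ` is unramified outside `{2, 3, 13}`
(no prime of the ring of integers of `L` lying above a prime `p ∉ {2,3,13}` has square
dividing `p·𝓞_L`). -/
theorem stmt18 :
    FiniteDimensional ℚ L18 ∧
    Module.finrank ℚ L18 = 8 ∧
    IsGalois ℚ L18 ∧
    Nonempty ((L18 ≃ₐ[ℚ] L18) ≃* DihedralGroup 4) ∧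
    (∀ p : ℕ, p.Prime → p ∉ ({2, 3, 13} : Set ℕ) →
      ¬ ∃ P : Ideal (integralClosure ℤ L18), P.IsPrime ∧ P ≠ ⊥ ∧
        P ^ 2 ∣ Ideal.span {(p : integralClosure ℤ L18)}) := by
  obtain ⟨a, b, hsum, hprod, htop⟩ := exists_generators_L18
  have hfin : FiniteDimensional ℚ L18 :=
    FiniteDimensional.of_finrank_pos (by rw [finrank_L18]; norm_num)
  have hgal : IsGalois ℚ L18 := isGalois_of_sq_add_sq_eq_eight hsum hprod htop
  have hcard : Nat.card Gal(L18/ℚ) = 8 := by rw [IsGalois.card_aut_eq_finrank, finrank_L18]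
  have : NumberField L18 := ⟨⟩
  refine ⟨hfin, finrank_L18, hgal, nonempty_mulEquiv_dihedralGroup hsum hprod htop hcard, ?_⟩
  rintro p hp hp' ⟨P, hP, -, hdvd⟩
  have hcop : p.Coprime 156 := by
    rw [hp.coprime_iff_not_dvd]
    intro h
    rw [show 156 = 2 ^ 2 * 3 * 13 by norm_num, hp.dvd_mul, hp.dvd_mul] at h
    apply hp'
    rcases h with (h | h) | h
    · exact Or.inl ((Nat.prime_dvd_prime_iff_eq hp Nat.prime_two).1 (hp.dvd_of_dvd_pow h))
    · exact Or.inr (Or.inl ((Nat.prime_dvd_prime_iff_eq hp Nat.prime_three).1 h))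
    · exact Or.inr (Or.inr ((Nat.prime_dvd_prime_iff_eq hp (by norm_num)).1 h))
  exact not_sq_dvd_span_of_sq_add_sq_eq_eight hsum hprod htop hp hcop (P := P) hP hdvd
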